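/- arXiv:1808.06864 — 2 statements merged into one kernel-verified Lean document; each statement's English description precedes it below -/
import Mathlib

section
/- For all β, γ ∈ (0,1) and every integer k ≥ 2 there exists N₀ such that the following holds for all N ≥ N₀. Let H be a 3-graph whose vertex set is partitioned into classes A and B with |A| ≥ N, such that every edge of H has exactly one vertex in B and two vertices in A. Suppose that for at least βN vertices v ∈ B, the link graph L(v) — the graph on A in which p and q are adjacent if and only if {v,p,q} ∈ E(H) — has at least (1/2+γ)|A| vertices of degree at least (1/2+γ)|A|. Then there exist distinct vertices x, y, w₁, …, w_{2k} ∈ A and 4k distinct vertices of B, one vertex b_F assigned to each of the 4k faces F of the double pyramid with apexes x, y over the cycle w₁…w_{2k} (the faces being the triples {x, w_i, w_{i+1}} and {y, w_i, w_{i+1}} for i modulo 2k), such that for every face F = {p,q,r} the three triples {p,q,b_F}, {q,r,b_F} and {r,p,b_F} are edges of H. (These 12k edges form a sphere in H with 4k vertices in B and 2k+2 vertices in A.) -/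
open scoped Classical

/-- If every element of a large enough `X` is related to a positive proportion of `Y`, then some
`t` elements of `X` have a positive proportion of `Y` as common neighbours. -/
lemma exists_subset_many_common_of_degree (δ : ℝ) (hδ : 0 < δ) (t : ℕ) :
    ∃ m : ℕ, ∃ δ' : ℝ, 0 < δ' ∧ ∀ {α β : Type} (X : Finset α) (Y : Finset β) (R : α → β → Prop),
      m ≤ X.card → (∀ x ∈ X, δ * Y.card ≤ ((Y.filter (R x)).card : ℝ)) →
      ∃ S ⊆ X, S.card = t ∧ δ' * Y.card ≤ ((Y.filter fun y => ∀ x ∈ S, R x y).card : ℝ) := by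
  obtain ⟨m₀, hm₀⟩ := exists_nat_ge (2 * t / δ)
  set m := max m₀ (t + 1) with hm
  have htm : t ≤ m := by omega
  have hmt : 2 * (t : ℝ) ≤ δ * m := by
    have h1 : (m₀ : ℝ) ≤ m := by exact_mod_cast le_max_left _ _
    have := (div_le_iff₀ hδ).1 (hm₀.trans h1)
    linarith
  have hm0 : (0 : ℝ) < m := by
    have : 0 < m := by omega
    exact_mod_cast this
  have hC : (0 : ℝ) < m.choose t := by exact_mod_cast Nat.choose_pos htm
  refine ⟨m, δ / 2 / m.choose t, by positivity, ?_⟩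
  intro α β X₀ Y R hX₀ hdeg
  obtain ⟨X, hXX, hX⟩ := Finset.exists_subset_card_eq hX₀
  set Y' := Y.filter fun y => t ≤ (X.filter fun x => R x y).card with hY'
  have hY'card : δ / 2 * Y.card ≤ (Y'.card : ℝ) := by
    have hcount : ∑ x ∈ X, (Y.filter (R x)).card = ∑ y ∈ Y, (X.filter fun x => R x y).card :=
      Finset.sum_card_bipartiteAbove_eq_sum_card_bipartiteBelow R
    have hlow : m * (δ * Y.card) ≤ ((∑ x ∈ X, (Y.filter (R x)).card : ℕ) : ℝ) := by
      rw [← hX, ← nsmul_eq_mul]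
      push_cast
      exact Finset.card_nsmul_le_sum _ _ _ fun x hx => hdeg x (hXX hx)
    have hup : ∑ y ∈ Y, (X.filter fun x => R x y).card ≤ m * Y'.card + t * Y.card := by
      have : ∀ y ∈ Y, (X.filter fun x => R x y).card ≤
          m * (if t ≤ (X.filter fun x => R x y).card then 1 else 0) + t := by
        intro y _
        have := Finset.card_filter_le X (fun x => R x y)
        split_ifs <;> omega
      refine (Finset.sum_le_sum this).trans (le_of_eq ?_)
      rw [Finset.sum_add_distrib, ← Finset.mul_sum, Finset.sum_boole, Finset.sum_const,
        smul_eq_mul, mul_comm Y.card]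
      rfl
    rw [hcount] at hlow
    have hup' : ((∑ y ∈ Y, (X.filter fun x => R x y).card : ℕ) : ℝ) ≤
        m * Y'.card + t * Y.card := by exact_mod_cast hup
    have hYn : (0 : ℝ) ≤ Y.card := by positivity
    have := mul_le_mul_of_nonneg_right hmt hYn
    refine le_of_mul_le_mul_left ?_ hm0
    linarith
  have hcover : Y'.card ≤ ∑ S ∈ X.powersetCard t, (Y.filter fun y => ∀ x ∈ S, R x y).card := by
    refine (Finset.card_le_card ?_).trans Finset.card_biUnion_le
    intro y hy
    obtain ⟨hyY, hyt⟩ := Finset.mem_filter.1 hy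
    obtain ⟨S, hSX, hS⟩ := Finset.exists_subset_card_eq hyt
    exact Finset.mem_biUnion.2 ⟨S, Finset.mem_powersetCard.2
      ⟨hSX.trans (Finset.filter_subset _ _), hS⟩,
      Finset.mem_filter.2 ⟨hyY, fun x hx => (Finset.mem_filter.1 (hSX hx)).2⟩⟩
  obtain ⟨S, hS, hle⟩ := Finset.exists_le_of_sum_le (s := X.powersetCard t)
    (f := fun _ => δ / 2 / m.choose t * (Y.card : ℝ))
    (g := fun S => ((Y.filter fun y => ∀ x ∈ S, R x y).card : ℝ))
    (Finset.powersetCard_nonempty.2 (by omega)) (by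
      have hcover' : (Y'.card : ℝ) ≤
          ∑ S ∈ X.powersetCard t, ((Y.filter fun y => ∀ x ∈ S, R x y).card : ℝ) := by
        exact_mod_cast hcover
      rw [Finset.sum_const, Finset.card_powersetCard, hX, nsmul_eq_mul]
      refine le_trans (le_of_eq ?_) (hY'card.trans hcover')
      field_simp)
  obtain ⟨hSX, hSt⟩ := Finset.mem_powersetCard.1 hS
  exact ⟨S, hSX.trans hXX, hSt, hle⟩

/-- If a relation between a large enough `X` and `Y` has positive density, then some `t` elements
of `X` have a positive proportion of `Y` as common neighbours. -/
lemma exists_subset_many_common_of_density (δ : ℝ) (hδ : 0 < δ) (t : ℕ) :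
    ∃ m : ℕ, ∃ δ' : ℝ, 0 < δ' ∧ ∀ {α β : Type} (X : Finset α) (Y : Finset β) (R : α → β → Prop),
      m ≤ X.card → 0 < Y.card →
      δ * (X.card * Y.card) ≤ (((X ×ˢ Y).filter fun z => R z.1 z.2).card : ℝ) →
      ∃ S ⊆ X, S.card = t ∧ δ' * Y.card ≤ ((Y.filter fun y => ∀ x ∈ S, R x y).card : ℝ) := by
  obtain ⟨m, δ', hδ', h⟩ := exists_subset_many_common_of_degree (δ / 2) (by positivity) t
  obtain ⟨M, hM⟩ := exists_nat_ge (m / (δ / 2))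
  refine ⟨M, δ', hδ', ?_⟩
  intro α β X Y R hX hY hdens
  have hYpos : (0 : ℝ) < Y.card := by exact_mod_cast hY
  set X' := X.filter fun x => δ / 2 * Y.card ≤ ((Y.filter (R x)).card : ℝ) with hX'
  have hcount : (((X ×ˢ Y).filter fun z => R z.1 z.2).card : ℝ) ≤
      X'.card * Y.card + X.card * (δ / 2 * Y.card) := by
    have h1 : ((X ×ˢ Y).filter fun z => R z.1 z.2).card = ∑ x ∈ X, (Y.filter (R x)).card := by
      simp only [Finset.card_filter, Finset.sum_product]
    rw [h1]
    push_cast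
    have : ∀ x ∈ X, ((Y.filter (R x)).card : ℝ) ≤
        (if δ / 2 * Y.card ≤ ((Y.filter (R x)).card : ℝ) then 1 else 0) * Y.card +
          δ / 2 * Y.card := by
      intro x _
      have hle : ((Y.filter (R x)).card : ℝ) ≤ Y.card := by
        exact_mod_cast Finset.card_filter_le _ _
      have : 0 ≤ δ / 2 * Y.card := by positivity
      split_ifs <;> linarith
    refine (Finset.sum_le_sum this).trans (le_of_eq ?_)
    rw [Finset.sum_add_distrib, ← Finset.sum_mul, Finset.sum_boole, Finset.sum_const,
      nsmul_eq_mul]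
  have hX'card : m ≤ X'.card := by
    have h1 : δ / 2 * X.card ≤ (X'.card : ℝ) := by
      refine le_of_mul_le_mul_right ?_ hYpos
      linarith
    have h2 : (M : ℝ) ≤ X.card := by exact_mod_cast hX
    have h3 := (div_le_iff₀ (by positivity)).1 (hM.trans h2)
    have : (m : ℝ) ≤ X'.card := by linarith
    exact_mod_cast this
  obtain ⟨S, hS, hSt, hle⟩ := h X' Y R hX'card fun x hx => (Finset.mem_filter.1 hx).2
  exact ⟨S, hS.trans (Finset.filter_subset _ _), hSt, hle⟩

/-- Two subsets of `A` of size at least `(1/2+γ)|A|` meet in at least `2γ|A|` elements. -/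
lemma two_mul_card_le_card_filter_and {V : Type} (A : Finset V) (γ : ℝ) (P Q : V → Prop)
    (hP : (1 / 2 + γ) * A.card ≤ ((A.filter P).card : ℝ))
    (hQ : (1 / 2 + γ) * A.card ≤ ((A.filter Q).card : ℝ)) :
    2 * γ * A.card ≤ ((A.filter fun a => P a ∧ Q a).card : ℝ) := by
  have h1 := Finset.card_union_add_card_inter (A.filter P) (A.filter Q)
  rw [← Finset.filter_and] at h1
  have h2 : (A.filter P ∪ A.filter Q).card ≤ A.card :=
    Finset.card_le_card (Finset.union_subset (Finset.filter_subset _ _) (Finset.filter_subset _ _))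
  have h3 : (A.filter P).card + (A.filter Q).card ≤
      A.card + (A.filter fun a => P a ∧ Q a).card := by omega
  have h4 : ((A.filter P).card : ℝ) + (A.filter Q).card ≤
      A.card + (A.filter fun a => P a ∧ Q a).card := by exact_mod_cast h3
  linarith

/-- A graph on `A` with at least `(1/2+γ)|A|` vertices of degree at least `(1/2+γ)|A|` contains
a positive proportion of all triples as triangles. -/
lemma many_triangles {V : Type} (A : Finset V) (γ : ℝ) (hγ : 0 < γ) (r : V → V → Prop)
    (h : (1 / 2 + γ) * A.card ≤
      ((A.filter fun p => (1 / 2 + γ) * A.card ≤ ((A.filter (r p)).card : ℝ)).card : ℝ)) :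
    2 * γ ^ 2 * (A ×ˢ A ×ˢ A).card ≤ (((A ×ˢ A ×ˢ A).filter fun z =>
      r z.1 z.2.1 ∧ r z.1 z.2.2 ∧ r z.2.1 z.2.2).card : ℝ) := by
  set n : ℝ := (A.card : ℝ) with hn
  have hn0 : 0 ≤ n := by positivity
  set S := A.filter fun p => (1 / 2 + γ) * n ≤ ((A.filter (r p)).card : ℝ) with hS
  have hcount : (((A ×ˢ A ×ˢ A).filter fun z =>
      r z.1 z.2.1 ∧ r z.1 z.2.2 ∧ r z.2.1 z.2.2).card : ℝ) =
      ∑ p ∈ A, ∑ q ∈ A, if r p q then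
        ((A.filter fun s => r p s ∧ r q s).card : ℝ) else 0 := by
    rw [Finset.card_filter, Finset.sum_product]
    push_cast
    refine Finset.sum_congr rfl fun p _ => ?_
    rw [Finset.sum_product]
    refine Finset.sum_congr rfl fun q _ => ?_
    split_ifs with hpq
    · simp [hpq]
    · simp [hpq]
  have hinner : ∀ p ∈ S, 2 * γ * n * (2 * γ * n) ≤ ∑ q ∈ A, if r p q then
        ((A.filter fun s => r p s ∧ r q s).card : ℝ) else 0 := by
    intro p hp
    have hp' := (Finset.mem_filter.1 hp).2
    have hT := two_mul_card_le_card_filter_and A γ (r p) _ hp' h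
    set T := A.filter fun q => r p q ∧ (1 / 2 + γ) * n ≤ ((A.filter (r q)).card : ℝ) with hTdef
    calc 2 * γ * n * (2 * γ * n) ≤ T.card * (2 * γ * n) := by gcongr
      _ = T.card • (2 * γ * n) := by rw [nsmul_eq_mul]
      _ ≤ ∑ q ∈ T, if r p q then ((A.filter fun s => r p s ∧ r q s).card : ℝ) else 0 := by
        refine Finset.card_nsmul_le_sum _ _ _ fun q hq => ?_
        obtain ⟨_, hpq, hq'⟩ := Finset.mem_filter.1 hq
        rw [if_pos hpq]
        exact two_mul_card_le_card_filter_and A γ (r p) (r q) hp' hq'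
      _ ≤ _ := by
        refine Finset.sum_le_sum_of_subset_of_nonneg (Finset.filter_subset _ _) fun q _ _ => ?_
        split_ifs <;> positivity
  rw [hcount]
  calc 2 * γ ^ 2 * ((A ×ˢ A ×ˢ A).card : ℝ) = 1 / 2 * n * (2 * γ * n * (2 * γ * n)) := by
        rw [Finset.card_product, Finset.card_product]; push_cast; ring
    _ ≤ S.card * (2 * γ * n * (2 * γ * n)) := by
        gcongr
        have : 0 ≤ γ * n := by positivity
        linarith
    _ = S.card • (2 * γ * n * (2 * γ * n)) := by rw [nsmul_eq_mul]
    _ ≤ ∑ p ∈ S, ∑ q ∈ A, if r p q then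
        ((A.filter fun s => r p s ∧ r q s).card : ℝ) else 0 := Finset.card_nsmul_le_sum _ _ _ hinner
    _ ≤ _ := by
        refine Finset.sum_le_sum_of_subset_of_nonneg (Finset.filter_subset _ _) fun p _ _ => ?_
        refine Finset.sum_nonneg fun q _ => ?_
        split_ifs <;> positivity

/-- Many graphs on a large set `A`, each with at least `(1/2+γ)|A|` vertices of degree at least
`(1/2+γ)|A|`: some `s` of them share all triangles of a complete tripartite `t₁ × t₂ × t₃`
pattern. -/
lemma exists_common_tripartite (γ : ℝ) (hγ : 0 < γ) (s t₁ t₂ t₃ : ℕ) :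
    ∃ N₀ : ℕ, ∀ (V : Type) (A G : Finset V) (r : V → V → V → Prop),
      N₀ ≤ A.card → N₀ ≤ G.card →
      (∀ b ∈ G, (1 / 2 + γ) * A.card ≤ ((A.filter fun p =>
        (1 / 2 + γ) * A.card ≤ ((A.filter (r b p)).card : ℝ)).card : ℝ)) →
      ∃ S ⊆ G, ∃ X ⊆ A, ∃ U ⊆ A, ∃ W ⊆ A,
        S.card = s ∧ X.card = t₁ ∧ U.card = t₂ ∧ W.card = t₃ ∧
        ∀ b ∈ S, ∀ x ∈ X, ∀ u ∈ U, ∀ w ∈ W, r b x u ∧ r b x w ∧ r b u w := by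
  obtain ⟨m₁, δ₁, hδ₁, h₁⟩ := exists_subset_many_common_of_degree (2 * γ ^ 2) (by positivity) s
  obtain ⟨m₂, δ₂, hδ₂, h₂⟩ := exists_subset_many_common_of_density δ₁ hδ₁ t₁
  obtain ⟨m₃, δ₃, hδ₃, h₃⟩ := exists_subset_many_common_of_density δ₂ hδ₂ t₂
  obtain ⟨m₄, hm₄⟩ := exists_nat_ge (t₃ / δ₃)
  refine ⟨m₁ + m₂ + m₃ + m₄ + 1, ?_⟩
  intro V A G r hA hG hdeg
  have hA0 : 0 < A.card := by omega
  obtain ⟨S, hSG, hS, hScard⟩ := h₁ G (A ×ˢ A ×ˢ A)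
    (fun b z => r b z.1 z.2.1 ∧ r b z.1 z.2.2 ∧ r b z.2.1 z.2.2) (by omega)
    fun b hb => by convert many_triangles A γ hγ (r b) (hdeg b hb)
  obtain ⟨X, hXA, hX, hXcard⟩ := h₂ A (A ×ˢ A)
    (fun x z => ∀ b ∈ S, r b x z.1 ∧ r b x z.2 ∧ r b z.1 z.2) (by omega)
    (by rw [Finset.card_product]; positivity)
    (by rw [Finset.card_product] at hScard; push_cast at hScard; convert hScard)
  obtain ⟨U, hUA, hU, hUcard⟩ := h₃ A A
    (fun u w => ∀ x ∈ X, ∀ b ∈ S, r b x u ∧ r b x w ∧ r b u w) (by omega) hA0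
    (by rw [Finset.card_product] at hXcard; push_cast at hXcard; convert hXcard)
  have hW : t₃ ≤ (A.filter fun w => ∀ u ∈ U, ∀ x ∈ X, ∀ b ∈ S,
      r b x u ∧ r b x w ∧ r b u w).card := by
    have h1 : (m₄ : ℝ) ≤ A.card := by
      have : m₄ ≤ A.card := by omega
      exact_mod_cast this
    have h2 := (div_le_iff₀ hδ₃).1 (hm₄.trans h1)
    have h3 := (by linarith : (t₃ : ℝ) ≤ δ₃ * A.card).trans hUcard
    convert (Nat.cast_le (α := ℝ)).1 h3
  obtain ⟨W, hWsub, hWcard⟩ := Finset.exists_subset_card_eq hW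
  exact ⟨S, hSG, X, hXA, U, hUA, W, hWsub.trans (Finset.filter_subset _ _), hS, hX, hU, hWcard,
    fun b hb x hx u hu w hw => (Finset.mem_filter.1 (hWsub hw)).2 u hu x hx b hb⟩

/-- A finite type injects into any finset of the same cardinality. -/
lemma exists_injective_forall_mem {ι V : Type} [Fintype ι] (S : Finset V)
    (h : S.card = Fintype.card ι) : ∃ f : ι → V, Function.Injective f ∧ ∀ i, f i ∈ S := by
  have e : ι ≃ S := Fintype.equivOfCardEq (by rw [Fintype.card_coe, h])
  exact ⟨fun i => e i, Subtype.val_injective.comp e.injective, fun i => (e i).2⟩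

/-- An edge with one vertex in `B` and two in `A`, written with its vertex of `B` first, has two
different further vertices. -/
lemma ne_of_mem_of_disjoint {V : Type} [DecidableEq V] {A B : Finset V} {E : Finset (Finset V)}
    (hAB : Disjoint A B)
    (hE : ∀ e ∈ E, ∃ b ∈ B, ∃ p ∈ A, ∃ q ∈ A, p ≠ q ∧ e = {b, p, q})
    {v p q : V} (h : ({v, p, q} : Finset V) ∈ E) : p ≠ q := by
  rintro rfl
  obtain ⟨b, hb, p', hp', q', hq', hne, heq⟩ := hE _ h
  have h1 : ({b, p', q'} : Finset V).card = 3 := Finset.card_eq_three.2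
    ⟨b, p', q', fun h => Finset.disjoint_left.1 hAB hp' (h ▸ hb),
      fun h => Finset.disjoint_left.1 hAB hq' (h ▸ hb), hne, rfl⟩
  rw [← heq, Finset.pair_eq_singleton] at h1
  have := Finset.card_le_two (a := v) (b := p)
  omega


/-- for all `β, γ ∈ (0,1)` and integer `k ≥ 2` there is `N₀` such that for
all `N ≥ N₀` the following holds. Let `H` be a 3-graph whose vertex set is partitioned into
`A` and `B` with `|A| ≥ N`, every edge having one vertex in `B` and two in `A`. If for at
least `βN` vertices `v ∈ B` the link graph `L(v)` has at least `(1/2+γ)|A|` vertices of degree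
at least `(1/2+γ)|A|`, then `H` contains a sphere consisting of a double pyramid on `2k+2`
vertices of `A` with one distinct vertex of `B` inserted into each of its `4k` faces. -/
theorem statement10 (β γ : ℝ) (hβ0 : 0 < β) (hβ1 : β < 1) (hγ0 : 0 < γ) (hγ1 : γ < 1)
    (k : ℕ) (hk : 2 ≤ k) :
    ∃ N₀ : ℕ, ∀ N : ℕ, N₀ ≤ N →
      ∀ (V : Type) [Fintype V] [DecidableEq V] (A B : Finset V) (E : Finset (Finset V)),
        Disjoint A B → A ∪ B = Finset.univ → N ≤ A.card →
        (∀ e ∈ E, ∃ b ∈ B, ∃ p ∈ A, ∃ q ∈ A, p ≠ q ∧ e = {b, p, q}) →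
        β * N ≤ ((B.filter fun v : V =>
            (1 / 2 + γ) * A.card ≤ ((A.filter fun p : V =>
              (1 / 2 + γ) * A.card ≤
                ((A.filter fun q : V => ({v, p, q} : Finset V) ∈ E).card : ℝ)).card : ℝ)).card : ℝ) →
        ∃ x ∈ A, ∃ y ∈ A, x ≠ y ∧
          ∃ w : ZMod (2 * k) → V, Function.Injective w ∧
            (∀ i, w i ∈ A ∧ w i ≠ x ∧ w i ≠ y) ∧
            ∃ b : Bool × ZMod (2 * k) → V, Function.Injective b ∧ (∀ f, b f ∈ B) ∧
              ∀ (s : Bool) (i : ZMod (2 * k)),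
                ({cond s x y, w i, b (s, i)} : Finset V) ∈ E ∧
                ({w i, w (i + 1), b (s, i)} : Finset V) ∈ E ∧
                ({w (i + 1), cond s x y, b (s, i)} : Finset V) ∈ E := by
  obtain ⟨N₁, hN₁⟩ := exists_common_tripartite γ hγ0 (4 * k) 2 (2 * k) (2 * k)
  obtain ⟨N₂, hN₂⟩ := exists_nat_ge (N₁ / β)
  refine ⟨max N₁ N₂, ?_⟩
  intro N hN V _ _ A B E hAB _ hNA hE hgood
  have : NeZero (2 * k) := ⟨by omega⟩
  set G := B.filter fun v : V => (1 / 2 + γ) * A.card ≤ ((A.filter fun p : V =>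
    (1 / 2 + γ) * A.card ≤
      ((A.filter fun q : V => ({v, p, q} : Finset V) ∈ E).card : ℝ)).card : ℝ) with hG
  have hGcard : N₁ ≤ G.card := by
    have h1 : (N₂ : ℝ) ≤ N := by exact_mod_cast (le_max_right _ _).trans hN
    have h2 := (div_le_iff₀ hβ0).1 (hN₂.trans h1)
    have : (N₁ : ℝ) ≤ G.card := by linarith
    exact_mod_cast this
  obtain ⟨S, hSG, X, hXA, U, hUA, W, hWA, hS, hX, hU, hW, htri⟩ :=
    hN₁ V A G (fun v p q => ({v, p, q} : Finset V) ∈ E)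
      (((le_max_left _ _).trans hN).trans hNA) hGcard fun b hb => by
        convert (Finset.mem_filter.1 hb).2
  obtain ⟨x, y, hxy, rfl⟩ := Finset.card_eq_two.1 hX
  obtain ⟨b, hbinj, hbS⟩ := exists_injective_forall_mem (ι := Bool × ZMod (2 * k)) S
    (by rw [hS, Fintype.card_prod, ZMod.card, Fintype.card_bool]; ring)
  obtain ⟨u, huinj, huU⟩ := exists_injective_forall_mem (ι := ZMod (2 * k)) U
    (by rw [hU, ZMod.card])
  obtain ⟨w, hwinj, hwW⟩ := exists_injective_forall_mem (ι := ZMod (2 * k)) W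
    (by rw [hW, ZMod.card])
  have hb₀ := hbS (true, 0)
  have hx : x ∈ ({x, y} : Finset V) := by simp
  have hy : y ∈ ({x, y} : Finset V) := by simp
  have hneXU : ∀ z ∈ ({x, y} : Finset V), ∀ i, u i ≠ z := fun z hz i =>
    (ne_of_mem_of_disjoint hAB hE (htri _ hb₀ z hz _ (huU i) _ (hwW i)).1).symm
  have hneXW : ∀ z ∈ ({x, y} : Finset V), ∀ i, w i ≠ z := fun z hz i =>
    (ne_of_mem_of_disjoint hAB hE (htri _ hb₀ z hz _ (huU i) _ (hwW i)).2.1).symm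
  have hneUW : ∀ i j, u i ≠ w j := fun i j =>
    ne_of_mem_of_disjoint hAB hE (htri _ hb₀ x hx _ (huU i) _ (hwW j)).2.2
  let φ : ZMod (2 * k) →+* ZMod 2 := ZMod.castHom (dvd_mul_right 2 k) (ZMod 2)
  have hrot : ∀ a p q : V, ({p, q, a} : Finset V) = {a, p, q} := by
    intro a p q
    ext
    simp only [Finset.mem_insert, Finset.mem_singleton]
    tauto
  refine ⟨x, hXA hx, y, hXA hy, hxy, fun i => if φ i = 0 then u i else w i, ?_, ?_, b, hbinj,
    fun f => (Finset.mem_filter.1 (hSG (hbS f))).1, ?_⟩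
  · intro i j hij
    dsimp only at hij
    split_ifs at hij
    · exact huinj hij
    · exact absurd hij (hneUW _ _)
    · exact absurd hij.symm (hneUW _ _)
    · exact hwinj hij
  · intro i
    dsimp only
    split_ifs
    · exact ⟨hUA (huU i), hneXU x hx i, hneXU y hy i⟩
    · exact ⟨hWA (hwW i), hneXW x hx i, hneXW y hy i⟩
  · intro s i
    have hz : cond s x y ∈ ({x, y} : Finset V) := by cases s <;> simp
    have hφ : φ (i + 1) = φ i + 1 := by rw [map_add, map_one]
    have hflip : ∀ a : ZMod 2, a + 1 = 0 ↔ a ≠ 0 := by decide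
    simp only [hφ, hflip, ne_eq, ite_not]
    split_ifs with h
    · obtain ⟨h1, h2, h3⟩ := htri _ (hbS (s, i)) _ hz _ (huU i) _ (hwW (i + 1))
      exact ⟨by rwa [hrot], by rwa [hrot], by rwa [hrot, Finset.pair_comm]⟩
    · obtain ⟨h1, h2, h3⟩ := htri _ (hbS (s, i)) _ hz _ (huU (i + 1)) _ (hwW i)
      exact ⟨by rwa [hrot], by rwa [hrot, Finset.pair_comm], by rwa [hrot, Finset.pair_comm]⟩
end

section
/- For every α > 0 there exists β > 0 such that the following holds for all n. If G is a bipartite graph with vertex classes X and Y satisfying αn ≤ |X| ≤ n, αn ≤ |Y| ≤ n and |E(G)| ≥ αn², then there exists a subset U ⊆ X with |U| ≥ βn such that for each x ∈ U there exists a subset U_x ⊆ U of size at least 3|U|/4 with |N_G(x) ∩ N_G(y)| ≥ βn for each y ∈ U_x. -/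
/-- If at most a sixteenth of the pairs in `N × N` satisfy `R`, then at least half of the elements
of `N` form a set `U` in which every element is `R`-related to at most a quarter of `U`. -/
theorem exists_subset_card_filter_not_ge {V : Type*} (N : Finset V) (R : V → V → Prop)
    [∀ x y, Decidable (R x y)]
    (h : 16 * ∑ x ∈ N, (N.filter (R x)).card ≤ N.card ^ 2) :
    ∃ U ⊆ N, N.card ≤ 2 * U.card ∧
      ∀ x ∈ U, 3 * U.card ≤ 4 * (U.filter fun y => ¬ R x y).card := by
  have hsplit := Finset.card_filter_add_card_filter_not (s := N)
    (fun x => 8 * (N.filter (R x)).card ≤ N.card)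
  have hW : (N.filter fun x => ¬ 8 * (N.filter (R x)).card ≤ N.card).card * N.card
      ≤ 8 * ∑ x ∈ N, (N.filter (R x)).card := by
    calc _ = ∑ x ∈ N.filter (fun x => ¬ 8 * (N.filter (R x)).card ≤ N.card), N.card := by simp
      _ ≤ ∑ x ∈ N.filter (fun x => ¬ 8 * (N.filter (R x)).card ≤ N.card),
            8 * (N.filter (R x)).card :=
          Finset.sum_le_sum fun x hx => (not_le.mp (Finset.mem_filter.mp hx).2).le
      _ ≤ ∑ x ∈ N, 8 * (N.filter (R x)).card :=
          Finset.sum_le_sum_of_subset (Finset.filter_subset _ _)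
      _ = _ := by rw [Finset.mul_sum]
  have hU : N.card ≤ 2 * (N.filter fun x => 8 * (N.filter (R x)).card ≤ N.card).card := by
    by_contra hlt
    nlinarith
  refine ⟨_, Finset.filter_subset _ N, hU, fun x hx => ?_⟩
  have hx8 := (Finset.mem_filter.mp hx).2
  set U := N.filter fun x => 8 * (N.filter (R x)).card ≤ N.card
  have hle : (U.filter (R x)).card ≤ (N.filter (R x)).card :=
    Finset.card_le_card (Finset.filter_subset_filter _ (Finset.filter_subset _ N))
  have := Finset.card_filter_add_card_filter_not (s := U) (R x)
  omega

/-- Double counting: summed over `z ∈ Y`, the pairs in the neighbourhood of `z` with fewer than `t`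
common neighbours number at most `t * |X| ^ 2`. -/
theorem SimpleGraph.sum_card_pairs_few_common_neighbors_le {V : Type*} [Fintype V] [DecidableEq V]
    (G : SimpleGraph V) [DecidableRel G.Adj] (X Y : Finset V)
    (hN : ∀ z ∈ Y, G.neighborFinset z ⊆ X) {t : ℝ} (ht : 0 ≤ t) (R : V → V → Prop)
    [∀ x y, Decidable (R x y)]
    (hR : ∀ x y, R x y → ((Finset.univ.filter fun z => G.Adj x z ∧ G.Adj y z).card : ℝ) ≤ t) :
    ∑ z ∈ Y, ∑ x ∈ G.neighborFinset z, (((G.neighborFinset z).filter (R x)).card : ℝ)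
      ≤ t * X.card ^ 2 := by
  have hz : ∀ z ∈ Y, ∑ x ∈ G.neighborFinset z, (((G.neighborFinset z).filter (R x)).card : ℝ)
      ≤ ∑ x ∈ X, ∑ y ∈ X, if R x y ∧ G.Adj x z ∧ G.Adj y z then (1 : ℝ) else 0 := by
    intro z hz
    refine (Finset.sum_le_sum fun x hx => ?_).trans
      (Finset.sum_le_sum_of_subset_of_nonneg (hN z hz) fun x _ _ =>
        Finset.sum_nonneg fun y _ => by split_ifs <;> norm_num)
    rw [Finset.sum_boole]
    gcongr
    intro y hy
    simp only [Finset.mem_filter, SimpleGraph.mem_neighborFinset] at hx hy ⊢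
    exact ⟨hN z hz ((G.mem_neighborFinset z y).2 hy.1), hy.2, hx.symm, hy.1.symm⟩
  refine (Finset.sum_le_sum hz).trans ?_
  rw [Finset.sum_comm]
  have hxy : ∀ x ∈ X, ∑ z ∈ Y, ∑ y ∈ X, (if R x y ∧ G.Adj x z ∧ G.Adj y z then (1 : ℝ) else 0)
      ≤ X.card * t := by
    intro x _
    rw [Finset.sum_comm, ← nsmul_eq_mul]
    refine Finset.sum_le_card_nsmul _ _ _ fun y _ => ?_
    rw [Finset.sum_boole]
    by_cases h : R x y
    · refine le_trans ?_ (hR x y h)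
      gcongr
      intro z
      simp only [Finset.mem_filter, Finset.mem_univ, true_and]
      tauto
    · simpa [h] using ht
  refine (Finset.sum_le_card_nsmul _ _ _ hxy).trans_eq ?_
  rw [nsmul_eq_mul]
  ring


/-- for every `α > 0` there is `β > 0` such that for all `n`, every bipartite
graph `G` with parts `X`, `Y`, `αn ≤ |X|, |Y| ≤ n` and `|E(G)| ≥ αn²`, contains a set
`U ⊆ X` with `|U| ≥ βn` such that each `x ∈ U` has a subset `U_x ⊆ U` of size at least
`3|U|/4` with `|N(x) ∩ N(y)| ≥ βn` for each `y ∈ U_x`. -/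
theorem statement13 (α : ℝ) (hα : 0 < α) :
    ∃ β : ℝ, 0 < β ∧ ∀ n : ℕ,
      ∀ (V : Type) [Fintype V] [DecidableEq V] (X Y : Finset V)
        (G : SimpleGraph V) [DecidableRel G.Adj],
        Disjoint X Y →
        (∀ u v : V, G.Adj u v → (u ∈ X ∧ v ∈ Y) ∨ (u ∈ Y ∧ v ∈ X)) →
        α * n ≤ (X.card : ℝ) → (X.card : ℝ) ≤ n →
        α * n ≤ (Y.card : ℝ) → (Y.card : ℝ) ≤ n →
        α * n ^ 2 ≤ (G.edgeFinset.card : ℝ) →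
        ∃ U ⊆ X, β * n ≤ (U.card : ℝ) ∧
          ∀ x ∈ U, ∃ Ux ⊆ U, (3 : ℝ) / 4 * U.card ≤ (Ux.card : ℝ) ∧
            ∀ y ∈ Ux,
              β * n ≤ ((Finset.univ.filter fun z : V => G.Adj x z ∧ G.Adj y z).card : ℝ) := by
  classical
  refine ⟨min (α / 4) (α ^ 2 / 32), by positivity, ?_⟩
  intro n V _ _ X Y G _ hXY hadj _ hXn hαY hYn hE
  have hβ₁ : min (α / 4) (α ^ 2 / 32) ≤ α / 4 := min_le_left _ _
  have hβ₂ : min (α / 4) (α ^ 2 / 32) ≤ α ^ 2 / 32 := min_le_right _ _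
  have hβ : 0 < min (α / 4) (α ^ 2 / 32) := by positivity
  generalize min (α / 4) (α ^ 2 / 32) = β at hβ hβ₁ hβ₂ ⊢
  rcases Nat.eq_zero_or_pos n with rfl | hn
  · exact ⟨∅, by simp, by simp, by simp⟩
  have hn' : (0 : ℝ) < n := by exact_mod_cast hn
  have hY : Y.Nonempty := by
    rw [← Finset.card_pos]
    exact_mod_cast (mul_pos hα hn').trans_le hαY
  have hbip : G.IsBipartiteWith (X : Set V) (Y : Set V) :=
    ⟨by exact_mod_cast hXY, fun {u v} h => by simpa using hadj u v h⟩
  have hN : ∀ z ∈ Y, G.neighborFinset z ⊆ X := fun z hz =>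
    SimpleGraph.isBipartiteWith_neighborFinset_subset' hbip hz
  let R : V → V → Prop := fun x y =>
    ((Finset.univ.filter fun z : V => G.Adj x z ∧ G.Adj y z).card : ℝ) < β * n
  let bad : V → ℝ := fun z =>
    ∑ x ∈ G.neighborFinset z, (((G.neighborFinset z).filter (R x)).card : ℝ)
  have hbad : ∑ z ∈ Y, bad z ≤ β * n * (n : ℝ) ^ 2 :=
    (G.sum_card_pairs_few_common_neighbors_le X Y hN (by positivity) R
      fun x y h => le_of_lt h).trans (by gcongr)
  have hdeg : ∑ z ∈ Y, (G.degree z : ℝ) = G.edgeFinset.card := by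
    exact_mod_cast SimpleGraph.isBipartiteWith_sum_degrees_eq_card_edges' hbip
  have hsq : α ^ 2 * (n : ℝ) ^ 3 ≤ ∑ z ∈ Y, (G.degree z : ℝ) ^ 2 := by
    have hcs := sq_sum_le_card_mul_sum_sq (s := Y) (f := fun z => (G.degree z : ℝ))
    rw [hdeg] at hcs
    have hS : 0 ≤ ∑ z ∈ Y, (G.degree z : ℝ) ^ 2 := by positivity
    have : (α * n ^ 2) ^ 2 ≤ (n : ℝ) * ∑ z ∈ Y, (G.degree z : ℝ) ^ 2 :=
      (pow_le_pow_left₀ (by positivity) hE 2).trans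
        (hcs.trans (mul_le_mul_of_nonneg_right hYn hS))
    refine le_of_mul_le_mul_left ?_ hn'
    linarith [this, show (n : ℝ) * (α ^ 2 * n ^ 3) = (α * n ^ 2) ^ 2 by ring]
  obtain ⟨z, hzY, hz⟩ : ∃ z ∈ Y, α ^ 2 / 2 * (n : ℝ) ^ 2 ≤ (G.degree z : ℝ) ^ 2 - 16 * bad z := by
    refine Finset.exists_le_of_sum_le hY ?_
    rw [Finset.sum_sub_distrib, ← Finset.mul_sum Y bad 16, Finset.sum_const, nsmul_eq_mul]
    have h₁ : (Y.card : ℝ) * (α ^ 2 / 2 * (n : ℝ) ^ 2) ≤ n * (α ^ 2 / 2 * (n : ℝ) ^ 2) := by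
      gcongr
    have h₂ : β * (n : ℝ) ^ 3 ≤ α ^ 2 / 32 * (n : ℝ) ^ 3 := by gcongr
    linarith
  have hbad0 : 0 ≤ bad z := Finset.sum_nonneg fun _ _ => Nat.cast_nonneg _
  have hpairs : 16 * ∑ x ∈ G.neighborFinset z, ((G.neighborFinset z).filter (R x)).card
      ≤ (G.neighborFinset z).card ^ 2 := by
    rw [SimpleGraph.card_neighborFinset_eq_degree]
    have : 16 * bad z ≤ (G.degree z : ℝ) ^ 2 := by
      have : 0 ≤ α ^ 2 / 2 * (n : ℝ) ^ 2 := by positivity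
      linarith
    simp only [bad] at this
    exact_mod_cast this
  have hd : α / 2 * n ≤ (G.degree z : ℝ) := by
    refine le_of_sq_le_sq ?_ (Nat.cast_nonneg _)
    nlinarith [mul_pos (pow_pos hα 2) (pow_pos hn' 2)]
  obtain ⟨U, hUN, hUcard, hU⟩ := exists_subset_card_filter_not_ge _ R hpairs
  rw [SimpleGraph.card_neighborFinset_eq_degree] at hUcard
  refine ⟨U, hUN.trans (hN z hzY), ?_, fun x hx =>
    ⟨U.filter fun y => ¬ R x y, Finset.filter_subset _ _, ?_, fun y hy => ?_⟩⟩
  · have h₁ : (G.degree z : ℝ) ≤ 2 * U.card := by exact_mod_cast hUcard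
    have h₂ : β * n ≤ α / 4 * n := by gcongr
    linarith
  · have h₁ : (3 : ℝ) * U.card ≤ 4 * (U.filter fun y => ¬ R x y).card := by
      exact_mod_cast hU x hx
    linarith
  · exact not_lt.mp (Finset.mem_filter.mp hy).2
end
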